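/- If h ∈ W^{m,2}([-1,1]) with m > 3/4, then the N-th truncation P_N h of the Legendre series of h satisfies ‖h - P_N h‖_∞ ≤ C ‖h‖_{W^{m,2}} / N^{m - 3/4} for a constant C independent of h and N. -/

import Mathlib

open Set Polynomial

/-- The `n`-th Legendre polynomial, via the Rodrigues formula. -/
noncomputable def legendreP (n : ℕ) : Polynomial ℝ :=
  Polynomial.C (1 / ((2 : ℝ) ^ n * n.factorial)) *
    Polynomial.derivative^[n] ((Polynomial.X ^ 2 - 1) ^ n)

/-- The `n`-th Legendre spectral coefficient of a function `h` on `[-1,1]`. -/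
noncomputable def legendreCoeff (h : ℝ → ℝ) (n : ℕ) : ℝ :=
  ((n : ℝ) + 1 / 2) * ∫ t in (-1 : ℝ)..1, h t * (legendreP n).eval t

lemma legendreP_zero : legendreP 0 = 1 := by simp [legendreP]

lemma legendreP_one : legendreP 1 = X := by
  have h : (C (1 / 2 : ℝ)) * 2 = 1 := by
    rw [← C_ofNat, ← C_mul]; norm_num
  simp only [legendreP, pow_one, Nat.factorial_one, Nat.cast_one, mul_one, Function.iterate_one,
    derivative_sub, derivative_X_pow, derivative_one, Nat.cast_ofNat, C_ofNat]
  linear_combination X * h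

lemma degree_legendreP_lt (n : ℕ) : (legendreP n).degree < (n + 1 : ℕ) := by
  refine lt_of_le_of_lt degree_le_natDegree ?_
  refine Nat.cast_lt.2 (Nat.lt_succ_of_le ?_)
  refine (natDegree_C_mul_le _ _).trans ((natDegree_iterate_derivative _ _).trans ?_)
  have h1 : ((X ^ 2 - 1 : ℝ[X]) ^ n).natDegree ≤ n * 2 := by
    refine natDegree_pow_le.trans ?_
    gcongr
    compute_degree
  omega

lemma coeff_legendreP_self_ne_zero (n : ℕ) : (legendreP n).coeff n ≠ 0 := by
  have hm : ((X ^ 2 - 1 : ℝ[X])).Monic := by monicity!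
  have hd : (X ^ 2 - 1 : ℝ[X]).natDegree = 2 := by compute_degree!
  have hc : ((X ^ 2 - 1 : ℝ[X]) ^ n).coeff (n + n) = 1 := by
    have := (hm.pow n).coeff_natDegree
    rwa [hm.natDegree_pow, hd, mul_two] at this
  rw [legendreP, coeff_C_mul, coeff_iterate_derivative, hc]
  have : (n + n).descFactorial n ≠ 0 := by
    rw [Ne, Nat.descFactorial_eq_zero_iff_lt]; omega
  have h2 : ((n.factorial : ℝ)) ≠ 0 := by positivity
  simp only [nsmul_eq_mul, mul_one]
  refine mul_ne_zero (by positivity) (by exact_mod_cast this)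

lemma eval_iterate_derivative_sq_sub_one_pow {n k : ℕ} (hk : k < n) {x : ℝ} (hx : x ^ 2 = 1) :
    (derivative^[k] ((X ^ 2 - 1 : ℝ[X]) ^ n)).eval x = 0 := by
  obtain ⟨q, hq⟩ := pow_sub_dvd_iterate_derivative_pow (X ^ 2 - 1 : ℝ[X]) n k
  rw [hq]
  have : n - k ≠ 0 := by omega
  simp [hx, this]

lemma eval_legendreP {x : ℝ} (hx : x ^ 2 = 1) (n : ℕ) : (legendreP n).eval x = x ^ n := by
  induction n with
  | zero => simp [legendreP_zero]
  | succ n ih =>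
    have h1 : derivative ((X ^ 2 - 1 : ℝ[X]) ^ (n + 1))
        = C (2 * ((n : ℝ) + 1)) * ((X ^ 2 - 1) ^ n * X) := by
      rw [derivative_pow_succ]
      simp only [derivative_sub, derivative_X_pow, derivative_one, map_mul, map_add, map_natCast,
        map_ofNat, map_one]
      push_cast
      ring
    have h2 : (derivative^[n] ((X ^ 2 - 1 : ℝ[X]) ^ n * X)).eval x
        = (derivative^[n] ((X ^ 2 - 1 : ℝ[X]) ^ n)).eval x * x := by
      rw [iterate_derivative_mul_X]
      rcases n with _ | n
      · simp
      · simp [eval_iterate_derivative_sq_sub_one_pow (Nat.lt_succ_self n) hx]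
    have hn : ((n.factorial : ℝ)) ≠ 0 := by positivity
    have hn' : (n : ℝ) + 1 ≠ 0 := by positivity
    rw [legendreP, eval_C_mul] at ih
    rw [legendreP, Function.iterate_succ_apply, h1, iterate_derivative_C_mul, eval_C_mul,
      eval_C_mul, h2, pow_succ x, ← ih, Nat.factorial_succ]
    push_cast
    field_simp
    ring

lemma derivative_legendreP_add_two (n : ℕ) :
    derivative (legendreP (n + 2))
      = C (2 * (n : ℝ) + 3) * legendreP (n + 1) + derivative (legendreP n) := by
  have h1 : derivative (derivative ((X ^ 2 - 1 : ℝ[X]) ^ (n + 2)))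
      = C (2 * ((n : ℝ) + 2) * (2 * (n : ℝ) + 3)) * (X ^ 2 - 1) ^ (n + 1)
        + C (4 * ((n : ℝ) + 2) * ((n : ℝ) + 1)) * (X ^ 2 - 1) ^ n := by
    rw [derivative_pow_succ]
    simp only [derivative_mul, derivative_pow_succ, derivative_sub, derivative_one, map_mul,
      map_add, map_natCast, map_ofNat, map_one, derivative_X, derivative_natCast]
    push_cast
    simp
    ring
  have hn : ((n.factorial : ℝ)) ≠ 0 := by positivity
  have hn' : (n : ℝ) + 1 ≠ 0 := by positivity
  have hn2 : (n : ℝ) + 2 ≠ 0 := by positivity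
  simp only [legendreP, derivative_C_mul]
  rw [← Function.iterate_succ_apply' (f := ⇑derivative), ← Function.iterate_succ_apply' (f := ⇑derivative),
    show (n + 2).succ = (n + 1) + 1 + 1 from rfl, Function.iterate_succ_apply,
    Function.iterate_succ_apply, h1, iterate_map_add, iterate_derivative_C_mul,
    iterate_derivative_C_mul, mul_add, ← mul_assoc, ← mul_assoc, ← mul_assoc, ← C_mul, ← C_mul,
    ← C_mul]
  simp only [Nat.factorial_succ]
  push_cast
  congr 3
  · field_simp
    ring
  · field_simp
    ring

lemma ContinuousOn.intervalIntegrable_neg_one_one {f : ℝ → ℝ} (hf : ContinuousOn f (Icc (-1) 1)) :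
    IntervalIntegrable f MeasureTheory.volume (-1) 1 :=
  hf.intervalIntegrable_of_Icc (by norm_num)

lemma integral_mul_eval_derivative {f f' : ℝ → ℝ}
    (hf : ∀ x ∈ Icc (-1 : ℝ) 1, HasDerivWithinAt f (f' x) (Icc (-1) 1) x)
    (hf' : ContinuousOn f' (Icc (-1) 1)) (p : ℝ[X]) :
    ∫ x in (-1 : ℝ)..1, f x * (derivative p).eval x
      = f 1 * p.eval 1 - f (-1) * p.eval (-1) - ∫ x in (-1 : ℝ)..1, f' x * p.eval x := by
  have hu : uIcc (-1 : ℝ) 1 = Icc (-1) 1 := uIcc_of_le (by norm_num)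
  refine intervalIntegral.integral_mul_deriv_eq_deriv_mul_of_hasDerivWithinAt
    (by rwa [hu]) (fun x _ => (p.hasDerivAt x).hasDerivWithinAt)
    hf'.intervalIntegrable_neg_one_one
    (Polynomial.continuous _).continuousOn.intervalIntegrable_neg_one_one

lemma integral_eval_mul_iterate_derivative_eq_zero (n : ℕ) {k : ℕ} (hk : k ≤ n) {q : ℝ[X]}
    (hq : q.degree < k) :
    ∫ x in (-1 : ℝ)..1, q.eval x * (derivative^[k] ((X ^ 2 - 1 : ℝ[X]) ^ n)).eval x = 0 := by
  induction k generalizing q with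
  | zero =>
    have : q = 0 := by
      rw [← degree_eq_bot]
      exact Nat.WithBot.lt_zero_iff.1 hq
    simp [this]
  | succ k ih =>
    rw [Function.iterate_succ_apply', integral_mul_eval_derivative
      (fun x _ => (q.hasDerivAt x).hasDerivWithinAt) (Polynomial.continuous _).continuousOn,
      eval_iterate_derivative_sq_sub_one_pow (by omega) (by norm_num),
      eval_iterate_derivative_sq_sub_one_pow (by omega) (by norm_num), ih (by omega)]
    · simp
    · rw [degree_lt_iff_coeff_zero] at hq ⊢
      intro m hm
      simp [coeff_derivative, hq (m + 1) (by omega)]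

lemma integral_eval_mul_legendreP_eq_zero {n : ℕ} {q : ℝ[X]} (hq : q.degree < n) :
    ∫ x in (-1 : ℝ)..1, q.eval x * (legendreP n).eval x = 0 := by
  have := integral_eval_mul_iterate_derivative_eq_zero n le_rfl hq
  simp only [legendreP, eval_C_mul, mul_left_comm (eval _ q)]
  rw [intervalIntegral.integral_const_mul, this, mul_zero]

lemma degree_derivative_legendreP_lt (n : ℕ) : (derivative (legendreP n)).degree < n := by
  have hq := degree_legendreP_lt n
  rw [degree_lt_iff_coeff_zero] at hq ⊢
  intro m hm
  simp [coeff_derivative, hq (m + 1) (by omega)]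

lemma integral_legendreP_mul_self (n : ℕ) :
    ∫ x in (-1 : ℝ)..1, (legendreP n).eval x * (legendreP n).eval x = 2 / (2 * n + 1) := by
  rcases n with _ | n
  · simp [legendreP_zero]; norm_num
  · have h1 := integral_mul_eval_derivative
      (fun x _ => ((legendreP (n + 1)).hasDerivAt x).hasDerivWithinAt)
      (Polynomial.continuous _).continuousOn (legendreP (n + 2))
    rw [derivative_legendreP_add_two,
      integral_eval_mul_legendreP_eq_zero
        ((degree_derivative_legendreP_lt (n + 1)).trans (by norm_cast; omega)),
      eval_legendreP (by norm_num), eval_legendreP (by norm_num), eval_legendreP (by norm_num),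
      eval_legendreP (by norm_num)] at h1
    simp only [eval_add, eval_C_mul, mul_add] at h1
    rw [intervalIntegral.integral_add
      (by apply Continuous.intervalIntegrable; fun_prop)
      (by apply Continuous.intervalIntegrable; fun_prop)] at h1
    simp only [mul_comm (eval _ (legendreP (n + 1))), mul_assoc] at h1
    rw [intervalIntegral.integral_const_mul, integral_eval_mul_legendreP_eq_zero
        ((degree_derivative_legendreP_lt n).trans (by norm_cast; omega))] at h1
    have h2 : (-1 : ℝ) ^ (n + 1) * (-1) ^ (n + 2) = -1 := by
      rw [← pow_add]; exact Odd.neg_one_pow ⟨n + 1, by ring⟩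
    rw [h2, one_pow, one_pow] at h1
    rw [eq_div_iff (by positivity)]
    push_cast
    linear_combination h1

lemma integral_legendreP_mul_legendreP_of_ne {k n : ℕ} (h : k ≠ n) :
    ∫ x in (-1 : ℝ)..1, (legendreP k).eval x * (legendreP n).eval x = 0 := by
  rcases h.lt_or_gt with h | h
  · exact integral_eval_mul_legendreP_eq_zero
      ((degree_legendreP_lt k).trans_le (by exact_mod_cast h))
  · simp only [mul_comm (eval _ (legendreP k))]
    exact integral_eval_mul_legendreP_eq_zero
      ((degree_legendreP_lt n).trans_le (by exact_mod_cast h))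

lemma integral_derivative_legendreP_sq (n : ℕ) :
    ∫ x in (-1 : ℝ)..1, (derivative (legendreP n)).eval x ^ 2 = n * (n + 1) := by
  induction n using Nat.twoStepInduction with
  | zero => simp [legendreP_zero]
  | one => simp [legendreP_one]
  | more n ih _ =>
    have h : ∀ x : ℝ, (derivative (legendreP (n + 2))).eval x ^ 2
        = (2 * n + 3) ^ 2 * ((legendreP (n + 1)).eval x * (legendreP (n + 1)).eval x)
          + 2 * (2 * n + 3) * ((derivative (legendreP n)).eval x * (legendreP (n + 1)).eval x)
          + (derivative (legendreP n)).eval x ^ 2 := by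
      intro x
      rw [derivative_legendreP_add_two]
      simp only [eval_add, eval_C_mul]
      ring
    simp only [h]
    rw [intervalIntegral.integral_add (by apply Continuous.intervalIntegrable; fun_prop)
      (by apply Continuous.intervalIntegrable; fun_prop),
      intervalIntegral.integral_add (by apply Continuous.intervalIntegrable; fun_prop)
      (by apply Continuous.intervalIntegrable; fun_prop), intervalIntegral.integral_const_mul,
      intervalIntegral.integral_const_mul, ih, integral_legendreP_mul_self,
      integral_eval_mul_legendreP_eq_zero
        ((degree_derivative_legendreP_lt n).trans (by norm_cast; omega))]
    push_cast
    have : (2 * ((n : ℝ) + 1) + 1) ≠ 0 := by positivity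
    field_simp
    ring

lemma exists_eq_sum_legendreP {N : ℕ} {q : ℝ[X]} (hq : q.degree < N) :
    ∃ c : ℕ → ℝ, q = ∑ n ∈ Finset.range N, C (c n) * legendreP n := by
  induction N generalizing q with
  | zero =>
    exact ⟨0, by simp [degree_eq_bot.1 (Nat.WithBot.lt_zero_iff.1 hq)]⟩
  | succ N ih =>
    set a := q.coeff N / (legendreP N).coeff N with ha
    have hr : (q - C a * legendreP N).degree < N := by
      have hP := degree_legendreP_lt N
      rw [degree_lt_iff_coeff_zero] at hq hP ⊢
      intro m hm
      rcases hm.eq_or_lt with rfl | hm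
      · simp [ha, coeff_legendreP_self_ne_zero N]
      · simp [hq m hm, hP m hm]
    obtain ⟨c, hc⟩ := ih hr
    refine ⟨Function.update c N a, ?_⟩
    rw [Finset.sum_range_succ, Function.update_self, ← sub_eq_iff_eq_add, hc]
    refine Finset.sum_congr rfl fun n hn => ?_
    rw [Function.update_of_ne (Finset.mem_range.1 hn).ne]

/-- The sum of the first `N` terms of the Legendre series of `f`, as a polynomial. -/
noncomputable def legendreTrunc (f : ℝ → ℝ) (N : ℕ) : ℝ[X] :=
  ∑ n ∈ Finset.range N, C (legendreCoeff f n) * legendreP n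

/-- The squared `L²([-1,1])` distance from `f` to the first `N` terms of its Legendre series. -/
noncomputable def legendreSqErr (f : ℝ → ℝ) (N : ℕ) : ℝ :=
  ∫ x in (-1 : ℝ)..1, (f x - (legendreTrunc f N).eval x) ^ 2

lemma legendreTrunc_succ (f : ℝ → ℝ) (N : ℕ) :
    legendreTrunc f (N + 1) = legendreTrunc f N + C (legendreCoeff f N) * legendreP N :=
  Finset.sum_range_succ _ _

lemma degree_legendreTrunc_lt (f : ℝ → ℝ) (N : ℕ) : (legendreTrunc f N).degree < N := by
  rw [degree_lt_iff_coeff_zero]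
  intro m hm
  rw [legendreTrunc, finsetSum_coeff]
  refine Finset.sum_eq_zero fun n hn => ?_
  have hP := degree_legendreP_lt n
  rw [degree_lt_iff_coeff_zero] at hP
  rw [coeff_C_mul, hP m (by have := Finset.mem_range.1 hn; omega), mul_zero]

lemma legendreSqErr_nonneg (f : ℝ → ℝ) (N : ℕ) : 0 ≤ legendreSqErr f N :=
  intervalIntegral.integral_nonneg (by norm_num) fun _ _ => sq_nonneg _

lemma integral_mul_legendreP (f : ℝ → ℝ) (n : ℕ) :
    ∫ x in (-1 : ℝ)..1, f x * (legendreP n).eval x = 2 / (2 * n + 1) * legendreCoeff f n := by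
  rw [legendreCoeff]
  have : 2 * (n : ℝ) + 1 ≠ 0 := by positivity
  field_simp

lemma integral_sum_mul_legendreP (c : ℕ → ℝ) (N n : ℕ) :
    ∫ x in (-1 : ℝ)..1, (∑ k ∈ Finset.range N, C (c k) * legendreP k).eval x * (legendreP n).eval x
      = if n < N then 2 / (2 * n + 1) * c n else 0 := by
  simp only [eval_finsetSum, eval_C_mul, Finset.sum_mul, mul_assoc]
  rw [intervalIntegral.integral_finsetSum
    (fun k _ => by apply Continuous.intervalIntegrable; fun_prop)]
  simp only [intervalIntegral.integral_const_mul]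
  split_ifs with h
  · rw [Finset.sum_eq_single_of_mem n (Finset.mem_range.2 h)
      (fun k _ hk => by rw [integral_legendreP_mul_legendreP_of_ne hk, mul_zero]),
      integral_legendreP_mul_self, mul_comm]
  · refine Finset.sum_eq_zero fun k hk => ?_
    have := Finset.mem_range.1 hk
    rw [integral_legendreP_mul_legendreP_of_ne (by omega), mul_zero]

lemma integral_sub_legendreTrunc_mul_legendreP {f : ℝ → ℝ} (hf : ContinuousOn f (Icc (-1) 1))
    (N n : ℕ) :
    ∫ x in (-1 : ℝ)..1, (f x - (legendreTrunc f N).eval x) * (legendreP n).eval x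
      = if n < N then 0 else 2 / (2 * n + 1) * legendreCoeff f n := by
  simp only [sub_mul]
  rw [intervalIntegral.integral_sub
    (ContinuousOn.intervalIntegrable_neg_one_one (by fun_prop))
    (ContinuousOn.intervalIntegrable_neg_one_one (by fun_prop)), integral_mul_legendreP,
    legendreTrunc, integral_sum_mul_legendreP]
  split_ifs <;> ring

lemma legendreSqErr_succ {f : ℝ → ℝ} (hf : ContinuousOn f (Icc (-1) 1)) (N : ℕ) :
    legendreSqErr f (N + 1)
      = legendreSqErr f N - 2 / (2 * N + 1) * legendreCoeff f N ^ 2 := by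
  have h : ∀ x : ℝ, (f x - (legendreTrunc f (N + 1)).eval x) ^ 2
      = (f x - (legendreTrunc f N).eval x) ^ 2
        - 2 * legendreCoeff f N * ((f x - (legendreTrunc f N).eval x) * (legendreP N).eval x)
        + legendreCoeff f N ^ 2 * ((legendreP N).eval x * (legendreP N).eval x) := by
    intro x
    rw [legendreTrunc_succ, eval_add, eval_C_mul]
    ring
  simp only [legendreSqErr, h]
  rw [intervalIntegral.integral_add
    (ContinuousOn.intervalIntegrable_neg_one_one (by fun_prop))
    (ContinuousOn.intervalIntegrable_neg_one_one (by fun_prop)), intervalIntegral.integral_sub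
    (ContinuousOn.intervalIntegrable_neg_one_one (by fun_prop))
    (ContinuousOn.intervalIntegrable_neg_one_one (by fun_prop)),
    intervalIntegral.integral_const_mul, intervalIntegral.integral_const_mul,
    integral_sub_legendreTrunc_mul_legendreP hf, integral_legendreP_mul_self, if_neg (by omega)]
  ring

lemma legendreSqErr_antitone {f : ℝ → ℝ} (hf : ContinuousOn f (Icc (-1) 1)) :
    Antitone (legendreSqErr f) := by
  refine antitone_nat_of_succ_le fun N => ?_
  rw [legendreSqErr_succ hf]
  have : 0 ≤ 2 / (2 * (N : ℝ) + 1) * legendreCoeff f N ^ 2 := by positivity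
  linarith

lemma legendreSqErr_zero (f : ℝ → ℝ) : legendreSqErr f 0 = ∫ x in (-1 : ℝ)..1, f x ^ 2 := by
  simp [legendreSqErr, legendreTrunc]

lemma legendreCoeff_sq_le {f : ℝ → ℝ} (hf : ContinuousOn f (Icc (-1) 1)) {N n : ℕ} (h : N ≤ n) :
    2 / (2 * (n : ℝ) + 1) * legendreCoeff f n ^ 2 ≤ legendreSqErr f N := by
  have h1 := legendreSqErr_succ hf n
  have h2 := legendreSqErr_nonneg f (n + 1)
  have h3 := legendreSqErr_antitone hf h
  linarith

lemma legendreSqErr_sub_legendreSqErr {f : ℝ → ℝ} (hf : ContinuousOn f (Icc (-1) 1)) {N M : ℕ}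
    (h : N ≤ M) :
    ∑ n ∈ Finset.Ico N M, 2 / (2 * (n : ℝ) + 1) * legendreCoeff f n ^ 2
      = legendreSqErr f N - legendreSqErr f M := by
  induction M, h using Nat.le_induction with
  | base => simp
  | succ M h ih =>
    rw [Finset.sum_Ico_succ_top h, ih, legendreSqErr_succ hf]
    ring

lemma legendreSqErr_le_integral {f : ℝ → ℝ} (hf : ContinuousOn f (Icc (-1) 1)) {N : ℕ} {q : ℝ[X]}
    (hq : q.degree < N) :
    legendreSqErr f N ≤ ∫ x in (-1 : ℝ)..1, (f x - q.eval x) ^ 2 := by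
  obtain ⟨c, hc⟩ := exists_eq_sum_legendreP
    ((degree_sub_le (legendreTrunc f N) q).trans_lt (max_lt (degree_legendreTrunc_lt f N) hq))
  have horth : ∫ x in (-1 : ℝ)..1,
      (f x - (legendreTrunc f N).eval x) * (legendreTrunc f N - q).eval x = 0 := by
    rw [hc]
    simp only [eval_finsetSum, eval_C_mul, Finset.mul_sum, mul_left_comm _ (c _)]
    rw [intervalIntegral.integral_finsetSum
      (fun k _ => ContinuousOn.intervalIntegrable_neg_one_one (by fun_prop))]
    refine Finset.sum_eq_zero fun n hn => ?_
    rw [intervalIntegral.integral_const_mul, integral_sub_legendreTrunc_mul_legendreP hf,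
      if_pos (Finset.mem_range.1 hn), mul_zero]
  have h : ∀ x : ℝ, (f x - q.eval x) ^ 2 = (f x - (legendreTrunc f N).eval x) ^ 2
        + 2 * ((f x - (legendreTrunc f N).eval x) * (legendreTrunc f N - q).eval x)
        + (legendreTrunc f N - q).eval x ^ 2 := by
    intro x
    rw [eval_sub]
    ring
  simp only [h]
  rw [intervalIntegral.integral_add
    (ContinuousOn.intervalIntegrable_neg_one_one (by fun_prop))
    (ContinuousOn.intervalIntegrable_neg_one_one (by fun_prop)), intervalIntegral.integral_add
    (ContinuousOn.intervalIntegrable_neg_one_one (by fun_prop))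
    (ContinuousOn.intervalIntegrable_neg_one_one (by fun_prop)),
    intervalIntegral.integral_const_mul, horth, mul_zero, add_zero]
  exact le_add_of_nonneg_right
    (intervalIntegral.integral_nonneg (by norm_num) fun _ _ => sq_nonneg _)

lemma exists_legendreSqErr_le {f : ℝ → ℝ} (hf : ContinuousOn f (Icc (-1) 1)) (N : ℕ) {ε : ℝ}
    (hε : 0 < ε) : ∃ M, N ≤ M ∧ legendreSqErr f M ≤ ε := by
  obtain ⟨q, hq⟩ := exists_polynomial_near_of_continuousOn (-1) 1 f hf (√(ε / 2)) (by positivity)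
  refine ⟨max N (q.natDegree + 1), le_max_left _ _, ?_⟩
  have hdeg : q.degree < (max N (q.natDegree + 1) : ℕ) :=
    degree_le_natDegree.trans_lt (by norm_cast; omega)
  refine (legendreSqErr_le_integral hf hdeg).trans ?_
  have : ∫ x in (-1 : ℝ)..1, (f x - q.eval x) ^ 2 ≤ ∫ x in (-1 : ℝ)..1, ε / 2 := by
    refine intervalIntegral.integral_mono_on (by norm_num)
      (ContinuousOn.intervalIntegrable_neg_one_one (by fun_prop)) (by simp) fun x hx => ?_
    have h1 := (hq x hx).le
    rw [abs_sub_comm] at h1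
    have h2 := pow_le_pow_left₀ (abs_nonneg _) h1 2
    rwa [sq_abs, Real.sq_sqrt (by positivity)] at h2
  refine this.trans (le_of_eq ?_)
  rw [intervalIntegral.integral_const]
  norm_num
  ring

lemma legendreCoeff_succ_eq {g g' : ℝ → ℝ}
    (hg : ∀ x ∈ Icc (-1 : ℝ) 1, HasDerivWithinAt g (g' x) (Icc (-1) 1) x)
    (hg' : ContinuousOn g' (Icc (-1) 1)) (n : ℕ) :
    legendreCoeff g (n + 1)
      = legendreCoeff g' n / (2 * n + 1) - legendreCoeff g' (n + 2) / (2 * n + 5) := by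
  have hc : ContinuousOn g (Icc (-1) 1) := fun x hx => (hg x hx).continuousWithinAt
  have h1 := integral_mul_eval_derivative hg hg' (legendreP n)
  have h2 := integral_mul_eval_derivative hg hg' (legendreP (n + 2))
  rw [integral_mul_legendreP, eval_legendreP (by norm_num), eval_legendreP (by norm_num)] at h1 h2
  have h3 : ∫ x in (-1 : ℝ)..1, g x * (derivative (legendreP (n + 2))).eval x
      = (2 * n + 3) * (∫ x in (-1 : ℝ)..1, g x * (legendreP (n + 1)).eval x)
        + ∫ x in (-1 : ℝ)..1, g x * (derivative (legendreP n)).eval x := by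
    rw [← intervalIntegral.integral_const_mul, ← intervalIntegral.integral_add
      (ContinuousOn.intervalIntegrable_neg_one_one (by fun_prop))
      (ContinuousOn.intervalIntegrable_neg_one_one (by fun_prop))]
    congr 1 with x
    rw [derivative_legendreP_add_two, eval_add, eval_C_mul]
    ring
  rw [h1, h2, integral_mul_legendreP] at h3
  push_cast at h3
  have e1 : (-1 : ℝ) ^ (n + 2) = (-1) ^ n := by ring
  rw [e1, one_pow, one_pow] at h3
  have e2 : (2 * ((n : ℝ) + 1) + 1) ≠ 0 := by positivity
  have e3 : (2 * ((n : ℝ) + 2) + 1) ≠ 0 := by positivity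
  have e4 : (2 * (n : ℝ) + 1) ≠ 0 := by positivity
  have e5 : (2 * (n : ℝ) + 5) ≠ 0 := by positivity
  have e6 : (2 * (n : ℝ) + 3) * (2 / (2 * ((n : ℝ) + 1) + 1) * legendreCoeff g (n + 1))
      = 2 * legendreCoeff g (n + 1) := by
    field_simp
    ring
  have e7 : 2 / (2 * ((n : ℝ) + 2) + 1) = 2 / (2 * n + 5) := by ring_nf
  rw [e6, e7] at h3
  linear_combination (-1 / 2) * h3

lemma sq_mul_legendreSqErr_succ_le {g g' : ℝ → ℝ}
    (hg : ∀ x ∈ Icc (-1 : ℝ) 1, HasDerivWithinAt g (g' x) (Icc (-1) 1) x)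
    (hg' : ContinuousOn g' (Icc (-1) 1)) {N : ℕ} (hN : 1 ≤ N) :
    (N : ℝ) ^ 2 * legendreSqErr g (N + 1) ≤ legendreSqErr g' N := by
  have hc : ContinuousOn g (Icc (-1) 1) := fun x hx => (hg x hx).continuousWithinAt
  have hN' : (1 : ℝ) ≤ N := by exact_mod_cast hN
  refine le_of_forall_pos_le_add fun ε hε => ?_
  obtain ⟨M, hM, hMε⟩ := exists_legendreSqErr_le hc (N + 1) (ε := ε / N ^ 2) (by positivity)
  obtain ⟨M, rfl⟩ := Nat.exists_eq_add_of_le' (le_trans (Nat.le_add_left 1 N) hM)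
  have hNM : N ≤ M := by omega
  have hsum := legendreSqErr_sub_legendreSqErr hc hM
  rw [← Finset.sum_Ico_add'] at hsum
  set β : ℕ → ℝ := fun n => 2 / (2 * (n : ℝ) + 1) * legendreCoeff g' n ^ 2 with hβ
  have h1 : ∑ n ∈ Finset.Ico N M, β n ≤ legendreSqErr g' N := by
    rw [legendreSqErr_sub_legendreSqErr hg' hNM]
    linarith [legendreSqErr_nonneg g' M]
  have h2 : ∑ n ∈ Finset.Ico N M, β (n + 2) ≤ legendreSqErr g' N := by
    rw [Finset.sum_Ico_add', legendreSqErr_sub_legendreSqErr hg' (by omega)]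
    linarith [legendreSqErr_nonneg g' (M + 2), legendreSqErr_antitone hg' (Nat.le_add_right N 2)]
  have hterm : ∀ n ∈ Finset.Ico N M,
      2 / (2 * ((n + 1 : ℕ) : ℝ) + 1) * legendreCoeff g (n + 1) ^ 2
        ≤ 1 / (2 * N ^ 2) * (β n + β (n + 2)) := by
    intro n hn
    have hn : (N : ℝ) ≤ n := by exact_mod_cast (Finset.mem_Ico.1 hn).1
    rw [legendreCoeff_succ_eq hg hg']
    set a := legendreCoeff g' n
    set b := legendreCoeff g' (n + 2)
    have hn0 : (1 : ℝ) ≤ n := hN'.trans hn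
    have k1 : 2 / ((2 * (n : ℝ) + 3) * (2 * n + 1)) ≤ 1 / (2 * N ^ 2) := by
      rw [div_le_div_iff₀ (by positivity) (by positivity)]
      nlinarith
    have k2 : 2 / ((2 * (n : ℝ) + 3) * (2 * n + 5)) ≤ 1 / (2 * N ^ 2) := by
      rw [div_le_div_iff₀ (by positivity) (by positivity)]
      nlinarith
    calc 2 / (2 * ((n + 1 : ℕ) : ℝ) + 1) * (a / (2 * n + 1) - b / (2 * n + 5)) ^ 2
        ≤ 2 / (2 * ((n + 1 : ℕ) : ℝ) + 1)
            * (2 * (a / (2 * n + 1)) ^ 2 + 2 * (b / (2 * n + 5)) ^ 2) := by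
          gcongr
          nlinarith [sq_nonneg (a / (2 * n + 1) + b / (2 * n + 5))]
      _ = 2 / ((2 * (n : ℝ) + 3) * (2 * n + 1)) * β n
            + 2 / ((2 * (n : ℝ) + 3) * (2 * n + 5)) * β (n + 2) := by
          simp only [hβ]
          have e : 2 * ((n : ℝ) + 1) + 1 = 2 * n + 3 := by ring
          have e' : 2 * ((n : ℝ) + 2) + 1 = 2 * n + 5 := by ring
          push_cast
          rw [e, e']
          field_simp
          ring
      _ ≤ 1 / (2 * N ^ 2) * β n + 1 / (2 * N ^ 2) * β (n + 2) := by
          have : ∀ n, 0 ≤ β n := fun n => by simp only [hβ]; positivity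
          gcongr
      _ = _ := by ring
  have h3 := Finset.sum_le_sum hterm
  rw [hsum, ← Finset.mul_sum, Finset.sum_add_distrib] at h3
  have h4 : legendreSqErr g (N + 1) ≤ 1 / (2 * N ^ 2) * (2 * legendreSqErr g' N) + ε / N ^ 2 := by
    have : 1 / (2 * (N : ℝ) ^ 2) * (∑ n ∈ Finset.Ico N M, β n + ∑ n ∈ Finset.Ico N M, β (n + 2))
        ≤ 1 / (2 * N ^ 2) * (2 * legendreSqErr g' N) := by
      gcongr
      linarith
    linarith
  calc (N : ℝ) ^ 2 * legendreSqErr g (N + 1)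
      ≤ N ^ 2 * (1 / (2 * N ^ 2) * (2 * legendreSqErr g' N) + ε / N ^ 2) := by gcongr
    _ = _ := by field_simp

lemma derivative_legendreTrunc {g g' : ℝ → ℝ}
    (hg : ∀ x ∈ Icc (-1 : ℝ) 1, HasDerivWithinAt g (g' x) (Icc (-1) 1) x)
    (hg' : ContinuousOn g' (Icc (-1) 1)) (N : ℕ) :
    derivative (legendreTrunc g (N + 2)) = legendreTrunc g' (N + 1)
      - C (legendreCoeff g' (N + 1) / (2 * N + 3)) * derivative (legendreP N)
      - C (legendreCoeff g' (N + 2) / (2 * N + 5)) * derivative (legendreP (N + 1)) := by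
  induction N with
  | zero =>
    simp [legendreTrunc, Finset.sum_range_succ, legendreP_zero, legendreP_one,
      legendreCoeff_succ_eq hg hg' 0]
  | succ N ih =>
    rw [legendreTrunc_succ, derivative_add, ih, legendreTrunc_succ g' (N + 1), derivative_C_mul,
      legendreCoeff_succ_eq hg hg', derivative_legendreP_add_two N]
    have e : C (legendreCoeff g' (N + 1))
        = C (legendreCoeff g' (N + 1) / (2 * (N : ℝ) + 3)) * C (2 * (N : ℝ) + 3) := by
      rw [← C_mul, div_mul_cancel₀ _ (by positivity)]
    have e1 : 2 * ((N + 1 : ℕ) : ℝ) + 1 = 2 * N + 3 := by push_cast; ring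
    have e3 : 2 * ((N + 1 : ℕ) : ℝ) + 3 = 2 * N + 5 := by push_cast; ring
    rw [e, e1, e3, C_sub]
    ring

lemma sq_le_of_hasDerivWithinAt {E E' : ℝ → ℝ}
    (hE : ∀ x ∈ Icc (-1 : ℝ) 1, HasDerivWithinAt E (E' x) (Icc (-1) 1) x)
    (hE' : ContinuousOn E' (Icc (-1) 1)) {l : ℝ} (hl : 0 < l) {x : ℝ} (hx : x ∈ Icc (-1 : ℝ) 1) :
    E x ^ 2 ≤ (1 / 2 + l) * (∫ t in (-1 : ℝ)..1, E t ^ 2)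
      + l⁻¹ * ∫ t in (-1 : ℝ)..1, E' t ^ 2 := by
  have hc : ContinuousOn E (Icc (-1) 1) := fun x hx => (hE x hx).continuousWithinAt
  set K := l * (∫ t in (-1 : ℝ)..1, E t ^ 2) + l⁻¹ * ∫ t in (-1 : ℝ)..1, E' t ^ 2 with hK
  have hxy : ∀ y ∈ Icc (-1 : ℝ) 1, E x ^ 2 ≤ E y ^ 2 + K := by
    intro y hy
    have hsub : uIcc y x ⊆ Icc (-1) 1 := uIcc_subset_Icc hy hx
    have h1 := intervalIntegral.integral_deriv_mul_eq_sub_of_hasDerivWithinAt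
      (a := y) (b := x) (u := E) (v := E) (u' := E') (v' := E')
      (fun z hz => (hE z (hsub hz)).mono hsub) (fun z hz => (hE z (hsub hz)).mono hsub)
      (hE'.mono hsub).intervalIntegrable (hE'.mono hsub).intervalIntegrable
    have h2 : |∫ t in y..x, E' t * E t + E t * E' t|
        ≤ |∫ t in (-1 : ℝ)..1, ‖E' t * E t + E t * E' t‖| := by
      rw [← Real.norm_eq_abs]
      refine (intervalIntegral.norm_integral_le_abs_integral_norm).trans ?_
      refine intervalIntegral.abs_integral_mono_interval ?_
        (Filter.Eventually.of_forall fun _ => norm_nonneg _)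
        (ContinuousOn.intervalIntegrable_neg_one_one (by fun_prop))
      rw [uIoc_of_le (by norm_num : (-1 : ℝ) ≤ 1), uIoc]
      exact Ioc_subset_Ioc (le_min hy.1 hx.1) (max_le hy.2 hx.2)
    have h3 : ∫ t in (-1 : ℝ)..1, ‖E' t * E t + E t * E' t‖ ≤ K := by
      rw [hK, ← intervalIntegral.integral_const_mul, ← intervalIntegral.integral_const_mul,
        ← intervalIntegral.integral_add
        (ContinuousOn.intervalIntegrable_neg_one_one (by fun_prop))
        (ContinuousOn.intervalIntegrable_neg_one_one (by fun_prop))]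
      refine intervalIntegral.integral_mono_on (by norm_num)
        (ContinuousOn.intervalIntegrable_neg_one_one (by fun_prop))
        (ContinuousOn.intervalIntegrable_neg_one_one (by fun_prop)) fun t _ => ?_
      have e : l * E t ^ 2 + l⁻¹ * E' t ^ 2 = l⁻¹ * ((l * E t) ^ 2 + E' t ^ 2) := by
        field_simp
      have e2 : E' t * E t + E t * E' t = l⁻¹ * (2 * (l * E t) * E' t) := by
        field_simp
        ring
      rw [e, e2, norm_mul, Real.norm_of_nonneg (by positivity)]
      gcongr
      rw [Real.norm_eq_abs, abs_le]
      constructor <;> nlinarith [sq_nonneg (l * E t + E' t), sq_nonneg (l * E t - E' t)]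
    rw [abs_of_nonneg (intervalIntegral.integral_nonneg (by norm_num) fun _ _ => norm_nonneg _)]
      at h2
    have h4 := (le_abs_self _).trans (h2.trans h3)
    rw [h1] at h4
    linarith
  have h := intervalIntegral.integral_mono_on (a := -1) (b := 1) (by norm_num)
    (f := fun _ => E x ^ 2) (g := fun y => E y ^ 2 + K)
    (by simp) (ContinuousOn.intervalIntegrable_neg_one_one (by fun_prop)) hxy
  rw [intervalIntegral.integral_add (ContinuousOn.intervalIntegrable_neg_one_one (by fun_prop))
    (by simp), intervalIntegral.integral_const, intervalIntegral.integral_const] at h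
  norm_num at h
  linarith

lemma integral_derivative_sub_legendreTrunc_sq_le {g g' : ℝ → ℝ}
    (hg : ∀ x ∈ Icc (-1 : ℝ) 1, HasDerivWithinAt g (g' x) (Icc (-1) 1) x)
    (hg' : ContinuousOn g' (Icc (-1) 1)) {N : ℕ} (hN : 1 ≤ N) :
    ∫ x in (-1 : ℝ)..1, (g' x - (derivative (legendreTrunc g (N + 1))).eval x) ^ 2
      ≤ 5 * N * legendreSqErr g' N := by
  obtain ⟨N, rfl⟩ := Nat.exists_eq_add_of_le' hN
  set D := legendreSqErr g' (N + 1) with hD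
  set c := legendreCoeff g' (N + 1) / (2 * N + 3) with hc
  set d := legendreCoeff g' (N + 2) / (2 * N + 5) with hd
  have hD0 : 0 ≤ D := legendreSqErr_nonneg _ _
  have hcD : c ^ 2 ≤ D / (2 * (2 * N + 3)) := by
    have h := legendreCoeff_sq_le hg' (le_refl (N + 1))
    have e : 2 * ((N + 1 : ℕ) : ℝ) + 1 = 2 * N + 3 := by push_cast; ring
    rw [e] at h
    rw [le_div_iff₀ (by positivity)]
    refine le_of_eq_of_le ?_ h
    rw [hc]
    field_simp
  have hdD : d ^ 2 ≤ D / (2 * (2 * N + 5)) := by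
    have h := legendreCoeff_sq_le hg' (Nat.le_succ (N + 1))
    have e : 2 * ((N + 1).succ : ℝ) + 1 = 2 * N + 5 := by push_cast; ring
    rw [e] at h
    rw [le_div_iff₀ (by positivity)]
    refine le_of_eq_of_le ?_ h
    rw [hd]
    field_simp
  have hle : ∀ x ∈ Icc (-1 : ℝ) 1, (g' x - (derivative (legendreTrunc g (N + 2))).eval x) ^ 2
      ≤ 3 * (g' x - (legendreTrunc g' (N + 1)).eval x) ^ 2
        + 3 * c ^ 2 * (derivative (legendreP N)).eval x ^ 2
        + 3 * d ^ 2 * (derivative (legendreP (N + 1))).eval x ^ 2 := by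
    intro x _
    rw [derivative_legendreTrunc hg hg', eval_sub, eval_sub, eval_C_mul, eval_C_mul]
    set u := g' x - (legendreTrunc g' (N + 1)).eval x with hu
    set p := (derivative (legendreP N)).eval x
    set q := (derivative (legendreP (N + 1))).eval x
    have e : g' x - ((legendreTrunc g' (N + 1)).eval x - c * p - d * q) = u + c * p + d * q := by
      rw [hu]
      ring
    rw [e]
    nlinarith [sq_nonneg (u - c * p), sq_nonneg (u - d * q), sq_nonneg (c * p - d * q)]
  refine (intervalIntegral.integral_mono_on (by norm_num)
    (ContinuousOn.intervalIntegrable_neg_one_one (by fun_prop))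
    (ContinuousOn.intervalIntegrable_neg_one_one (by fun_prop)) hle).trans ?_
  rw [intervalIntegral.integral_add
    (ContinuousOn.intervalIntegrable_neg_one_one (by fun_prop))
    (ContinuousOn.intervalIntegrable_neg_one_one (by fun_prop)), intervalIntegral.integral_add
    (ContinuousOn.intervalIntegrable_neg_one_one (by fun_prop))
    (ContinuousOn.intervalIntegrable_neg_one_one (by fun_prop)),
    intervalIntegral.integral_const_mul, intervalIntegral.integral_const_mul,
    intervalIntegral.integral_const_mul, integral_derivative_legendreP_sq,
    integral_derivative_legendreP_sq, ← legendreSqErr, ← hD]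
  have h1 : c ^ 2 * (N * (N + 1)) ≤ D * (N + 1) / 4 := by
    calc c ^ 2 * (N * (N + 1)) ≤ D / (2 * (2 * N + 3)) * (N * (N + 1)) := by gcongr
      _ = D * (N + 1) / 4 * (2 * N / (2 * N + 3)) := by field_simp; ring
      _ ≤ D * (N + 1) / 4 * 1 := by
        gcongr
        rw [div_le_one (by positivity)]
        linarith
      _ = _ := mul_one _
  have h2 : d ^ 2 * ((N + 1) * (N + 1 + 1)) ≤ D * (N + 1) / 4 := by
    calc d ^ 2 * ((N + 1) * (N + 1 + 1)) ≤ D / (2 * (2 * N + 5)) * ((N + 1) * (N + 1 + 1)) := by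
          gcongr
      _ = D * (N + 1) / 4 * (2 * (N + 2) / (2 * N + 5)) := by field_simp; ring
      _ ≤ D * (N + 1) / 4 * 1 := by
        gcongr
        rw [div_le_one (by positivity)]
        linarith
      _ = _ := mul_one _
  push_cast
  nlinarith [mul_nonneg hD0 (Nat.cast_nonneg (α := ℝ) N)]

lemma sub_legendreTrunc_sq_le {g g' : ℝ → ℝ}
    (hg : ∀ x ∈ Icc (-1 : ℝ) 1, HasDerivWithinAt g (g' x) (Icc (-1) 1) x)
    (hg' : ContinuousOn g' (Icc (-1) 1)) {N : ℕ} (hN : 1 ≤ N) {x : ℝ}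
    (hx : x ∈ Icc (-1 : ℝ) 1) :
    (g x - (legendreTrunc g (N + 1)).eval x) ^ 2 ≤ 7 * legendreSqErr g' N / √N := by
  have h := sq_le_of_hasDerivWithinAt
    (E := fun t => g t - (legendreTrunc g (N + 1)).eval t)
    (E' := fun t => g' t - (derivative (legendreTrunc g (N + 1))).eval t)
    (fun t ht => (hg t ht).sub ((legendreTrunc g (N + 1)).hasDerivAt t).hasDerivWithinAt)
    (by fun_prop) (l := N * √N) (by positivity) hx
  refine h.trans ?_
  have h1 := sq_mul_legendreSqErr_succ_le hg hg' hN
  have h2 := integral_derivative_sub_legendreTrunc_sq_le hg hg' hN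
  rw [← legendreSqErr]
  set D := legendreSqErr g' N
  have hD0 : 0 ≤ D := legendreSqErr_nonneg _ _
  have hN' : (1 : ℝ) ≤ N := by exact_mod_cast hN
  obtain ⟨s, hs1, hs⟩ : ∃ s : ℝ, 1 ≤ s ∧ (N : ℝ) = s ^ 2 :=
    ⟨√N, Real.one_le_sqrt.2 hN', (Real.sq_sqrt (by positivity)).symm⟩
  rw [hs] at h1 h2 ⊢
  rw [Real.sqrt_sq (by positivity)]
  have h3 : legendreSqErr g (N + 1) ≤ D / s ^ 4 := by
    rw [le_div_iff₀ (by positivity)]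
    exact le_of_eq_of_le (by ring) h1
  calc (1 / 2 + s ^ 2 * s) * legendreSqErr g (N + 1) + (s ^ 2 * s)⁻¹ * _
      ≤ (1 / 2 + s ^ 2 * s) * (D / s ^ 4) + (s ^ 2 * s)⁻¹ * (5 * s ^ 2 * D) := by gcongr
    _ = D / s * (1 / (2 * s ^ 3) + 6) := by field_simp; ring
    _ ≤ D / s * 7 := by
      gcongr
      have : 1 / (2 * s ^ 3) ≤ 1 := by
        rw [div_le_one (by positivity)]
        nlinarith [one_le_pow₀ hs1 (n := 3)]
      linarith
    _ = _ := by ring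

lemma exists_legendreSqErr_le_sum (k : ℕ) :
    ∃ C : ℝ, 0 < C ∧ ∀ f : ℕ → ℝ → ℝ,
      (∀ j < k, ∀ x ∈ Icc (-1 : ℝ) 1, HasDerivWithinAt (f j) (f (j + 1) x) (Icc (-1) 1) x) →
      (∀ j ≤ k, ContinuousOn (f j) (Icc (-1) 1)) →
      ∀ N : ℕ, 1 ≤ N → (N : ℝ) ^ (2 * k) * legendreSqErr (f 0) N
        ≤ C * ∑ j ∈ Finset.range (k + 1), ∫ x in (-1 : ℝ)..1, f j x ^ 2 := by
  have hnn : ∀ g : ℝ → ℝ, 0 ≤ ∫ x in (-1 : ℝ)..1, g x ^ 2 := fun g =>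
    intervalIntegral.integral_nonneg (by norm_num) fun _ _ => sq_nonneg _
  induction k with
  | zero =>
    refine ⟨1, one_pos, fun f _ hf N _ => ?_⟩
    simpa [← legendreSqErr_zero] using legendreSqErr_antitone (hf 0 le_rfl) (Nat.zero_le N)
  | succ k ih =>
    obtain ⟨C, hC, h⟩ := ih
    refine ⟨4 ^ (k + 1) * C + 1, by positivity, fun f hd hf N hN => ?_⟩
    rw [Finset.sum_range_succ', ← legendreSqErr_zero]
    have hS : 0 ≤ ∑ j ∈ Finset.range (k + 1), ∫ x in (-1 : ℝ)..1, f (j + 1) x ^ 2 :=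
      Finset.sum_nonneg fun j _ => hnn _
    have h0 : 0 ≤ legendreSqErr (f 0) 0 := legendreSqErr_nonneg _ _
    rcases hN.eq_or_lt with rfl | hN
    · have := legendreSqErr_antitone (hf 0 (by omega)) (Nat.zero_le 1)
      have h4 : 0 ≤ 4 ^ (k + 1) * C := by positivity
      simp only [Nat.cast_one, one_pow, one_mul]
      nlinarith [mul_nonneg h4 hS, mul_nonneg h4 h0]
    · obtain ⟨L, rfl⟩ := Nat.exists_eq_add_of_le' hN.le
      have hL : 1 ≤ L := by omega
      have hL' : (1 : ℝ) ≤ L := by exact_mod_cast hL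
      have h1 := h (fun j => f (j + 1)) (fun j hj => hd (j + 1) (by omega))
        (fun j hj => hf (j + 1) (by omega)) L hL
      have h2 := sq_mul_legendreSqErr_succ_le (hd 0 (by omega)) (hf 1 (by omega)) hL
      have hE := legendreSqErr_nonneg (f 0) (L + 1)
      calc ((L + 1 : ℕ) : ℝ) ^ (2 * (k + 1)) * legendreSqErr (f 0) (L + 1)
          ≤ (2 * L) ^ (2 * (k + 1)) * legendreSqErr (f 0) (L + 1) := by
            gcongr
            push_cast
            linarith
        _ = 4 ^ (k + 1) * (L ^ (2 * k) * (L ^ 2 * legendreSqErr (f 0) (L + 1))) := by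
            rw [mul_pow, pow_mul 2 2]
            norm_num
            ring
        _ ≤ 4 ^ (k + 1) * (L ^ (2 * k) * legendreSqErr (f 1) L) := by gcongr
        _ ≤ 4 ^ (k + 1)
              * (C * ∑ j ∈ Finset.range (k + 1), ∫ x in (-1 : ℝ)..1, f (j + 1) x ^ 2) := by
            gcongr
        _ ≤ _ := by
            have h4 : 0 ≤ 4 ^ (k + 1) * C := by positivity
            nlinarith [mul_nonneg h4 h0]

/-- Truncation error of the Legendre series in `W^{m,2}`, `m > 3/4`: there is a
constant `C` independent of `h` and `N` with
`‖h - P_N h‖_∞ ≤ C ‖h‖_{W^{m,2}} / N^{m-3/4}`. -/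
theorem stmt6_legendre_truncation_Wm2
    (m : ℕ) (hm : 3 / 4 < (m : ℝ)) :
    ∃ C : ℝ, 0 < C ∧
      ∀ (h : ℝ → ℝ) (S : ℝ),
        ContDiffOn ℝ m h (Icc (-1 : ℝ) 1) →
        (∑ j ∈ Finset.range (m + 1),
          Real.sqrt (∫ x in (-1 : ℝ)..1,
            (iteratedDerivWithin j h (Icc (-1 : ℝ) 1) x) ^ 2)) ≤ S →
        ∀ N : ℕ, 1 ≤ N →
          ∀ x ∈ Icc (-1 : ℝ) 1,
            |h x - ∑ n ∈ Finset.range (N + 1), legendreCoeff h n * (legendreP n).eval x|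
              ≤ C * S / (N : ℝ) ^ ((m : ℝ) - 3 / 4) := by
  obtain ⟨k, rfl⟩ : ∃ k, m = k + 1 := Nat.exists_eq_succ_of_ne_zero (by
    rintro rfl
    norm_num at hm)
  obtain ⟨C, hC, hCk⟩ := exists_legendreSqErr_le_sum k
  refine ⟨√(7 * C), by positivity, fun h S hh hS N hN x hx => ?_⟩
  have hu : UniqueDiffOn ℝ (Icc (-1 : ℝ) 1) := uniqueDiffOn_Icc (by norm_num)
  set f : ℕ → ℝ → ℝ := fun j => iteratedDerivWithin j h (Icc (-1 : ℝ) 1) with hf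
  have hcont : ∀ j ≤ k + 1, ContinuousOn (f j) (Icc (-1) 1) := fun j hj =>
    hh.continuousOn_iteratedDerivWithin (by exact_mod_cast hj) hu
  have hder : ∀ j < k + 1, ∀ x ∈ Icc (-1 : ℝ) 1,
      HasDerivWithinAt (f j) (f (j + 1) x) (Icc (-1) 1) x := by
    intro j hj x hx
    simp only [hf, iteratedDerivWithin_succ]
    exact (hh.differentiableOn_iteratedDerivWithin (by exact_mod_cast hj) hu x hx).hasDerivWithinAt
  have hf0 : f 0 = h := by simp [hf]
  have h1 := hCk (fun j => f (j + 1)) (fun j hj => hder (j + 1) (by omega))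
    (fun j hj => hcont (j + 1) (by omega)) N hN
  have h2 := sub_legendreTrunc_sq_le (hder 0 (by omega)) (hcont 1 (by omega)) hN hx
  rw [hf0, legendreTrunc, eval_finsetSum] at h2
  simp only [eval_C_mul] at h2
  have hnn : ∀ j, 0 ≤ ∫ x in (-1 : ℝ)..1, f j x ^ 2 := fun j =>
    intervalIntegral.integral_nonneg (by norm_num) fun _ _ => sq_nonneg _
  have hS0 : 0 ≤ S := le_trans (Finset.sum_nonneg fun j _ => Real.sqrt_nonneg _) hS
  have hsum : ∑ j ∈ Finset.range (k + 1), ∫ x in (-1 : ℝ)..1, f (j + 1) x ^ 2 ≤ S ^ 2 := by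
    calc ∑ j ∈ Finset.range (k + 1), ∫ x in (-1 : ℝ)..1, f (j + 1) x ^ 2
        ≤ ∑ j ∈ Finset.range (k + 1 + 1), ∫ x in (-1 : ℝ)..1, f j x ^ 2 := by
          rw [Finset.sum_range_succ' _ (k + 1)]
          exact le_add_of_nonneg_right (hnn 0)
      _ = ∑ j ∈ Finset.range (k + 1 + 1), √(∫ x in (-1 : ℝ)..1, f j x ^ 2) ^ 2 :=
          Finset.sum_congr rfl fun j _ => (Real.sq_sqrt (hnn j)).symm
      _ ≤ (∑ j ∈ Finset.range (k + 1 + 1), √(∫ x in (-1 : ℝ)..1, f j x ^ 2)) ^ 2 :=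
          Finset.sum_sq_le_sq_sum_of_nonneg fun j _ => Real.sqrt_nonneg _
      _ ≤ S ^ 2 := by gcongr
  have hN' : (0 : ℝ) < N := by exact_mod_cast hN
  have hpow : ((N : ℝ) ^ (((k + 1 : ℕ) : ℝ) - 3 / 4)) ^ 2 = N ^ (2 * k) * √N := by
    rw [← Real.rpow_natCast, ← Real.rpow_mul hN'.le, Real.sqrt_eq_rpow, ← Real.rpow_natCast,
      ← Real.rpow_add hN']
    congr 1
    push_cast
    ring
  refine abs_le_of_sq_le_sq (h2.trans ?_) (by positivity)
  rw [div_pow, mul_pow, Real.sq_sqrt (by positivity), hpow,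
    div_le_div_iff₀ (by positivity) (by positivity)]
  have h3 : (N : ℝ) ^ (2 * k) * legendreSqErr (f 1) N ≤ C * S ^ 2 :=
    h1.trans (by gcongr)
  calc 7 * legendreSqErr (f (0 + 1)) N * (N ^ (2 * k) * √N)
      = 7 * (N ^ (2 * k) * legendreSqErr (f 1) N) * √N := by ring
    _ ≤ 7 * (C * S ^ 2) * √N := by gcongr
    _ = _ := by ring
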